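/- Let p and q be coprime integers with 0 < p < q. Suppose p/q = [e₁, …, e_k] and (q−p)/q = [e′₁, …, e′_l], where all the integers e_i and e′_i are ≥ 2. Then ∑_{i=1}^{k} (e_i − 1) = k + l − 1, i.e. the number of blow-ups needed to produce the chain of k + l + 1 curves from the first blow-up equals the total number of curves minus two. -/

import Mathlib

/-- Hirzebruch–Jung continued fraction of a list of integers:
`hjcf [] = 0`, `hjcf (e :: l) = 1 / (e - hjcf l)`, so that `hjcf [e] = 1/e`. -/
def hjcf : List ℤ → ℚ
  | [] => 0
  | e :: l => 1 / ((e : ℚ) - hjcf l)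

theorem hjcf_mem_Ico (l : List ℤ) (h : ∀ x ∈ l, 2 ≤ x) : 0 ≤ hjcf l ∧ hjcf l < 1 := by
  induction l with
  | nil => simp [hjcf]
  | cons a t ih =>
    obtain ⟨h0, h1⟩ := ih fun x hx => h x (List.mem_cons_of_mem _ hx)
    have ha : (2 : ℚ) ≤ a := by exact_mod_cast h a List.mem_cons_self
    have hd : 1 < (a : ℚ) - hjcf t := by linarith
    exact ⟨by simp only [hjcf]; positivity, by
      simp only [hjcf]; rw [div_lt_one (by linarith)]; exact hd⟩

theorem hjcf_cons_pos (a : ℤ) (t : List ℤ) (h : ∀ x ∈ a :: t, 2 ≤ x) : 0 < hjcf (a :: t) := by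
  obtain ⟨_, h1⟩ := hjcf_mem_Ico t fun x hx => h x (List.mem_cons_of_mem _ hx)
  have ha : (2 : ℚ) ≤ a := by exact_mod_cast h a List.mem_cons_self
  have hd : 0 < (a : ℚ) - hjcf t := by linarith
  simp only [hjcf]
  positivity

/-- Two expansions `a :: s` and `b :: t` have values summing to `1` exactly when the
denominators `u = a - hjcf s` and `v = b - hjcf t` satisfy `u + v = u * v`. -/
theorem hjcf_cons_add_hjcf_cons_eq_one_iff {a b : ℤ} {s t : List ℤ}
    (ha : (a : ℚ) - hjcf s ≠ 0) (hb : (b : ℚ) - hjcf t ≠ 0) :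
    hjcf (a :: s) + hjcf (b :: t) = 1 ↔
      (a - hjcf s) + (b - hjcf t) = (a - hjcf s) * (b - hjcf t) := by
  simp only [hjcf]
  rw [div_add_div _ _ ha hb, div_eq_one_iff_eq (mul_ne_zero ha hb)]
  constructor <;> intro h <;> linarith

/-- If the first entry of one expansion is `2` and its tail is nonempty, then the tail is
complementary to the other expansion with its first entry lowered by one. -/
theorem hjcf_add_hjcf_sub_one {b : ℤ} {s t : List ℤ} (hb : 3 ≤ b) (ht : hjcf t < 1)
    (h : hjcf (2 :: s) + hjcf (b :: t) = 1) (hs : hjcf s < 1) :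
    hjcf s + hjcf ((b - 1) :: t) = 1 := by
  have hb' : (3 : ℚ) ≤ b := by exact_mod_cast hb
  rw [hjcf_cons_add_hjcf_cons_eq_one_iff (by push_cast; linarith) (by linarith)] at h
  have hd : ((b - 1 : ℤ) : ℚ) - hjcf t ≠ 0 := by push_cast; linarith
  rw [hjcf]
  field_simp
  push_cast at h ⊢
  linarith

theorem sum_sub_one_of_hjcf_add_hjcf_eq_one (n : ℕ) : ∀ e e' : List ℤ,
    e.length + e'.length ≤ n → e ≠ [] → e' ≠ [] → (∀ x ∈ e, 2 ≤ x) → (∀ x ∈ e', 2 ≤ x) →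
    hjcf e + hjcf e' = 1 →
    (e.map (fun x => x - 1)).sum = (e.length : ℤ) + (e'.length : ℤ) - 1 := by
  induction n with
  | zero =>
    intro e e' hn he
    have := List.length_pos_iff.mpr he
    omega
  | succ n ih =>
    rintro (_ | ⟨a, s⟩) (_ | ⟨b, t⟩) hn he he' h2 h2' h
    · exact absurd rfl he
    · exact absurd rfl he
    · exact absurd rfl he'
    have ha := h2 a List.mem_cons_self
    have hb := h2' b List.mem_cons_self
    have h2s : ∀ x ∈ s, 2 ≤ x := fun x hx => h2 x (List.mem_cons_of_mem _ hx)
    have h2t : ∀ x ∈ t, 2 ≤ x := fun x hx => h2' x (List.mem_cons_of_mem _ hx)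
    obtain ⟨hs0, hs1⟩ := hjcf_mem_Ico s h2s
    obtain ⟨ht0, ht1⟩ := hjcf_mem_Ico t h2t
    have haq : (2 : ℚ) ≤ a := by exact_mod_cast ha
    have hbq : (2 : ℚ) ≤ b := by exact_mod_cast hb
    have huv := (hjcf_cons_add_hjcf_cons_eq_one_iff (by linarith) (by linarith)).mp h
    simp only [List.length_cons] at hn
    rcases ha.eq_or_lt with rfl | ha3
    · rcases hb.eq_or_lt with rfl | hb3
      · push_cast at huv
        have hs : hjcf s = 0 := by nlinarith
        have ht : hjcf t = 0 := by nlinarith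
        cases s with
        | cons c s => exact absurd hs (hjcf_cons_pos c s h2s).ne'
        | nil =>
          cases t with
          | cons c t => exact absurd ht (hjcf_cons_pos c t h2t).ne'
          | nil => simp
      · have hsum := hjcf_add_hjcf_sub_one hb3 ht1 h hs1
        have h2b : ∀ x ∈ (b - 1) :: t, 2 ≤ x := by
          intro x hx
          rcases List.mem_cons.mp hx with rfl | hx
          · omega
          · exact h2t x hx
        have hsne : s ≠ [] := by
          rintro rfl
          have := (hjcf_mem_Ico _ h2b).2
          simp only [hjcf] at hsum this
          linarith
        have := ih s ((b - 1) :: t) (by simp only [List.length_cons]; omega) hsne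
          (List.cons_ne_nil _ _) h2s h2b hsum
        simp only [List.map_cons, List.sum_cons, List.length_cons] at this ⊢
        push_cast at this ⊢
        linarith
    · rcases hb.eq_or_lt with rfl | hb3
      · rw [add_comm] at h
        have hsum := hjcf_add_hjcf_sub_one ha3 hs1 h ht1
        have h2a : ∀ x ∈ (a - 1) :: s, 2 ≤ x := by
          intro x hx
          rcases List.mem_cons.mp hx with rfl | hx
          · omega
          · exact h2s x hx
        have htne : t ≠ [] := by
          rintro rfl
          have := (hjcf_mem_Ico _ h2a).2
          simp only [hjcf] at hsum this
          linarith
        rw [add_comm] at hsum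
        have := ih ((a - 1) :: s) t (by simp only [List.length_cons]; omega)
          (List.cons_ne_nil _ _) htne h2a h2t hsum
        simp only [List.map_cons, List.sum_cons, List.length_cons] at this ⊢
        push_cast at this ⊢
        linarith
      · have ha3q : (3 : ℚ) ≤ a := by exact_mod_cast ha3
        have hb3q : (3 : ℚ) ≤ b := by exact_mod_cast hb3
        nlinarith [mul_pos (show 0 < (a : ℚ) - hjcf s - 2 by linarith)
          (show 0 < (b : ℚ) - hjcf t - 2 by linarith)]

/-- If p/q = [e₁, …, e_k] and (q−p)/q = [e′₁, …, e′_l] with all entries ≥ 2,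
then ∑ᵢ (eᵢ − 1) = k + l − 1. -/
theorem hjcf_blowup_count (p q : ℤ) (hp : 0 < p) (hpq : p < q)
    (hco : IsCoprime p q)
    (e e' : List ℤ) (he : e ≠ []) (he' : e' ≠ [])
    (h2 : ∀ x ∈ e, 2 ≤ x) (h2' : ∀ x ∈ e', 2 ≤ x)
    (hv : (p : ℚ) / (q : ℚ) = hjcf e)
    (hv' : ((q - p : ℤ) : ℚ) / (q : ℚ) = hjcf e') :
    (e.map (fun x => x - 1)).sum = (e.length : ℤ) + (e'.length : ℤ) - 1 := by
  refine sum_sub_one_of_hjcf_add_hjcf_eq_one _ e e' le_rfl he he' h2 h2' ?_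
  have hq : (q : ℚ) ≠ 0 := by exact_mod_cast (hp.trans hpq).ne'
  rw [← hv, ← hv']
  field_simp
  push_cast
  ring
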